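/- Consider the accelerated inexact proximal-gradient method: y_k = x_k + ((k−1)/(k+2))(x_k − x_{k-1}) with y_0 = x_0, and for each k ≥ 1, x_k is an ε_k-optimal solution of the proximal problem at y_{k-1} − (1/L)(g'(y_{k-1}) + e_k). Define θ_k = 2/(k+1), v_k = x_{k-1} + (1/θ_k)(x_k − x_{k-1}), Ã_k = Σ_{i=1}^k i( ‖e_i‖/L + √(2ε_i/L) ) and B̃_k = Σ_{i=1}^k i² ε_i / L. Then for all 1 ≤ i ≤ k, ‖v_i − x*‖ ≤ ‖x_0 − x*‖ + 2Ã_k + √(2 B̃_k). -/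

import Mathlib

open scoped RealInnerProductSpace
open Finset

noncomputable section

variable {E : Type*} [NormedAddCommGroup E] [InnerProductSpace ℝ E] [CompleteSpace E]

/-- The ε-subdifferential of an `EReal`-valued function `a` at `x`:
the set of `y` such that `a t ≥ a x + ⟪y, t - x⟫ - ε` for all `t`. -/
def epsSubdiff (a : E → EReal) (ε : ℝ) (x : E) : Set E :=
  {y | ∀ t : E, a x + ((⟪y, t - x⟫ : ℝ) : EReal) - ((ε : ℝ) : EReal) ≤ a t}

/-- The objective function of the proximal problem at `y`. -/
def proxObj (L : ℝ) (h : E → EReal) (y x : E) : EReal :=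
  ((L / 2 * ‖x - y‖ ^ 2 : ℝ) : EReal) + h x

/-- `x` is an `ε`-optimal solution of the proximal problem at `y`. -/
def IsEpsOptimal (L : ℝ) (h : E → EReal) (ε : ℝ) (y x : E) : Prop :=
  proxObj L h y x ≤ ((ε : ℝ) : EReal) + ⨅ z : E, proxObj L h y z

/-- Convexity for `EReal`-valued functions. -/
def ERealConvexOn (h : E → EReal) : Prop :=
  ∀ x y : E, ∀ a b : ℝ, 0 ≤ a → 0 ≤ b → a + b = 1 →
    h (a • x + b • y) ≤ ((a : ℝ) : EReal) * h x + ((b : ℝ) : EReal) * h y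

lemma hasDerivAt_comp_line {g : E → ℝ} {g' : E → E} (hgrad : ∀ w, HasGradientAt g (g' w) w)
    (y d : E) (s : ℝ) : HasDerivAt (fun s : ℝ => g (y + s • d)) ⟪g' (y + s • d), d⟫ s := by
  have hline : HasDerivAt (fun s : ℝ => y + s • d) d s := by
    simpa using ((hasDerivAt_id s).smul_const d).const_add y
  exact (hgrad (y + s • d)).hasFDerivAt.comp_hasDerivAt s hline

/-- A differentiable convex function lies above its tangent planes. -/
lemma ConvexOn.add_inner_gradient_le {g : E → ℝ} {g' : E → E} (hg : ConvexOn ℝ Set.univ g)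
    (hgrad : ∀ w, HasGradientAt g (g' w) w) (y t : E) : g y + ⟪g' y, t - y⟫ ≤ g t := by
  have hconv : ConvexOn ℝ Set.univ (fun s : ℝ => g (y + s • (t - y))) := by
    have := hg.comp_affineMap (AffineMap.lineMap y t : ℝ →ᵃ[ℝ] E)
    simpa [Function.comp_def, AffineMap.lineMap_apply, add_comm] using this
  have hslope := hconv.le_slope_of_hasDerivAt (Set.mem_univ 0) (Set.mem_univ 1) zero_lt_one
    (hasDerivAt_comp_line hgrad y (t - y) 0)
  simp [slope_def_field] at hslope
  linarith

/-- The descent lemma for functions with `L`-Lipschitz gradient. -/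
lemma le_add_inner_gradient_add_sq {g : E → ℝ} {g' : E → E} {L : ℝ}
    (hgrad : ∀ w, HasGradientAt g (g' w) w) (hlip : ∀ w w', ‖g' w - g' w'‖ ≤ L * ‖w - w'‖)
    (y t : E) : g t ≤ g y + ⟪g' y, t - y⟫ + L / 2 * ‖t - y‖ ^ 2 := by
  set d := t - y with hd
  have hderiv (s : ℝ) : HasDerivAt
      (fun s : ℝ => g (y + s • d) - s * ⟪g' y, d⟫ - s ^ 2 * (L / 2 * ‖d‖ ^ 2))
      (⟪g' (y + s • d), d⟫ - ⟪g' y, d⟫ - 2 * s * (L / 2 * ‖d‖ ^ 2)) s := by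
    refine ((hasDerivAt_comp_line hgrad y d s).sub ?_).sub ?_
    · simpa using (hasDerivAt_id s).mul_const ⟪g' y, d⟫
    · simpa using (hasDerivAt_pow 2 s).mul_const (L / 2 * ‖d‖ ^ 2)
  have hanti := antitoneOn_of_deriv_nonpos (convex_Icc (0 : ℝ) 1)
    (fun s _ => (hderiv s).continuousAt.continuousWithinAt)
    (fun s _ => (hderiv s).differentiableAt.differentiableWithinAt) fun s hs => by
      rw [interior_Icc] at hs
      rw [(hderiv s).deriv, ← inner_sub_left]
      have hnorm : ‖g' (y + s • d) - g' y‖ ≤ L * (s * ‖d‖) := by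
        simpa [norm_smul, abs_of_pos hs.1] using hlip (y + s • d) y
      nlinarith [real_inner_le_norm (g' (y + s • d) - g' y) d,
        mul_le_mul_of_nonneg_right hnorm (norm_nonneg d)]
  have h01 := hanti (Set.left_mem_Icc.2 zero_le_one) (Set.right_mem_Icc.2 zero_le_one) zero_le_one
  simp [hd] at h01
  linarith

lemma ERealConvexOn.toReal_le {F : Type*} [NormedAddCommGroup F] [InnerProductSpace ℝ F]
    {h : F → EReal} (hconv : ERealConvexOn h) (hbot : ∀ w, h w ≠ ⊥)
    {x y : F} (hx : h x ≠ ⊤) (hy : h y ≠ ⊤) {a b : ℝ} (ha : 0 ≤ a) (hb : 0 ≤ b) (hab : a + b = 1) :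
    h (a • x + b • y) ≠ ⊤ ∧
      (h (a • x + b • y)).toReal ≤ a * (h x).toReal + b * (h y).toReal := by
  have hle := hconv x y a b ha hb hab
  rw [← EReal.coe_toReal hx (hbot x), ← EReal.coe_toReal hy (hbot y)] at hle
  norm_cast at hle
  have htop : h (a • x + b • y) ≠ ⊤ := (hle.trans_lt (EReal.coe_lt_top _)).ne
  refine ⟨htop, ?_⟩
  rw [← EReal.coe_toReal htop (hbot _)] at hle
  exact_mod_cast hle

lemma IsEpsOptimal.toReal_le {F : Type*} [NormedAddCommGroup F]
    {h : F → EReal} {L ε : ℝ} {z x t : F}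
    (hopt : IsEpsOptimal L h ε z x) (hbot : ∀ w, h w ≠ ⊥) (ht : h t ≠ ⊤) :
    h x ≠ ⊤ ∧ L / 2 * ‖x - z‖ ^ 2 + (h x).toReal ≤
      ε + (L / 2 * ‖t - z‖ ^ 2 + (h t).toReal) := by
  have hle : proxObj L h z x ≤ (ε : EReal) + proxObj L h z t :=
    hopt.trans (add_le_add le_rfl (iInf_le _ t))
  unfold proxObj at hle
  rw [← EReal.coe_toReal ht (hbot t)] at hle
  have htop : h x ≠ ⊤ := by
    intro hx
    rw [hx, EReal.coe_add_top, top_le_iff] at hle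
    exact absurd hle (by norm_cast; exact EReal.coe_ne_top _)
  refine ⟨htop, ?_⟩
  rw [← EReal.coe_toReal htop (hbot x)] at hle
  exact_mod_cast hle

/-- If `s * D ≤ ε + L / 2 * s ^ 2 * n ^ 2` for all `s ∈ (0, 1]`, then
`D ≤ L * √(2 * ε / L) * n + ε`. -/
lemma le_sqrt_mul_add_of_forall {L ε D n : ℝ} (hL : 0 < L) (hε : 0 ≤ ε) (hn : 0 ≤ n)
    (hD : ∀ s : ℝ, 0 < s → s ≤ 1 → s * D ≤ ε + L / 2 * s ^ 2 * n ^ 2) :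
    D ≤ L * √(2 * ε / L) * n + ε := by
  set r := √(2 * ε / L) with hr
  have hr0 : 0 ≤ r := Real.sqrt_nonneg _
  have hεr : ε = L / 2 * r ^ 2 := by
    rw [hr, Real.sq_sqrt (by positivity)]
    field_simp
  rcases le_or_gt n r with hnr | hnr
  · have := hD 1 one_pos le_rfl
    nlinarith [mul_le_mul_of_nonneg_left (mul_le_mul_of_nonneg_right hnr hn) hL.le,
      mul_nonneg hL.le (mul_nonneg hr0 hn)]
  · have hn' : 0 < n := hr0.trans_lt hnr
    rcases hr0.eq_or_lt with hr00 | hr00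
    · have hε0 : ε = 0 := by rw [hεr, ← hr00]; ring
      rw [← hr00, hε0]
      refine le_of_forall_pos_le_add fun δ hδ => ?_
      set s := min 1 (δ / (L / 2 * n ^ 2)) with hs
      have hs0 : 0 < s := by positivity
      have hsδ : s * (L / 2 * n ^ 2) ≤ δ := by
        rw [← le_div_iff₀ (by positivity)]
        exact min_le_right _ _
      have h1 := hD s hs0 (min_le_left _ _)
      have h2 : s * D ≤ s * (s * (L / 2 * n ^ 2)) := by rw [hε0] at h1; linarith
      linarith [le_of_mul_le_mul_left h2 hs0]
    · have h1 := hD (r / n) (by positivity) ((div_le_one hn').2 hnr.le)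
      have h2 : r / n * D ≤ r / n * (L * r * n) := by
        refine h1.trans (le_of_eq ?_)
        rw [hεr]
        field_simp
        ring
      linarith [le_of_mul_le_mul_left h2 (by positivity)]

/-- The approximate variational inequality satisfied by an `ε`-optimal solution of a proximal
problem. -/
lemma IsEpsOptimal.variational {F : Type*} [NormedAddCommGroup F] [InnerProductSpace ℝ F]
    {h : F → EReal} {L ε : ℝ} {z x t : F} (hL : 0 < L) (hε : 0 ≤ ε)
    (hconv : ERealConvexOn h) (hbot : ∀ w, h w ≠ ⊥)
    (hopt : IsEpsOptimal L h ε z x) (ht : h t ≠ ⊤) :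
    (h x).toReal ≤ (h t).toReal + L * ⟪x - z, t - x⟫ + L * √(2 * ε / L) * ‖t - x‖ + ε := by
  have hx := (hopt.toReal_le hbot ht).1
  suffices hD : (h x).toReal - (h t).toReal - L * ⟪x - z, t - x⟫ ≤
      L * √(2 * ε / L) * ‖t - x‖ + ε by linarith
  refine le_sqrt_mul_add_of_forall hL hε (norm_nonneg _) fun s hs0 hs1 => ?_
  obtain ⟨hw, hwle⟩ := hconv.toReal_le hbot hx ht (sub_nonneg.2 hs1) hs0.le (by ring)
  have hle := (hopt.toReal_le hbot hw).2
  have hsub : (1 - s) • x + s • t - z = (x - z) + s • (t - x) := by module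
  rw [hsub, norm_add_sq_real, inner_smul_right, norm_smul, Real.norm_of_nonneg hs0.le] at hle
  linarith

/-- The basic inequality for one inexact proximal-gradient step. -/
lemma proximalGradient_step {g : E → ℝ} {g' : E → E} {h : E → EReal} {L ε : ℝ} {y x t e : E}
    (hL : 0 < L) (hε : 0 ≤ ε) (hg : ConvexOn ℝ Set.univ g)
    (hgrad : ∀ w, HasGradientAt g (g' w) w) (hlip : ∀ w w', ‖g' w - g' w'‖ ≤ L * ‖w - w'‖)
    (hconv : ERealConvexOn h) (hbot : ∀ w, h w ≠ ⊥)
    (hopt : IsEpsOptimal L h ε (y - (1 / L) • (g' y + e)) x) (ht : h t ≠ ⊤) :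
    g x + (h x).toReal ≤ g t + (h t).toReal + L / 2 * (‖t - y‖ ^ 2 - ‖t - x‖ ^ 2) +
      L * (‖e‖ / L + √(2 * ε / L)) * ‖t - x‖ + ε := by
  have hvar := hopt.variational hL hε hconv hbot ht
  have hup := le_add_inner_gradient_add_sq hgrad hlip y x
  have hlow := hg.add_inner_gradient_le hgrad y t
  have hin : L * ⟪x - (y - (1 / L) • (g' y + e)), t - x⟫ =
      L * ⟪x - y, t - x⟫ + ⟪g' y, t - x⟫ + ⟪e, t - x⟫ := by
    rw [← sub_add, inner_add_left, inner_smul_left, inner_add_left]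
    simp
    field_simp
    ring
  have hsq : ‖t - y‖ ^ 2 = ‖t - x‖ ^ 2 + 2 * ⟪x - y, t - x⟫ + ‖x - y‖ ^ 2 := by
    rw [← sub_add_sub_cancel t x y, norm_add_sq_real, real_inner_comm]
  have hsplit : ⟪g' y, t - y⟫ = ⟪g' y, t - x⟫ + ⟪g' y, x - y⟫ := by
    rw [← inner_add_right, sub_add_sub_cancel]
  have hcancel : L * (‖e‖ / L + √(2 * ε / L)) * ‖t - x‖ =
      ‖e‖ * ‖t - x‖ + L * √(2 * ε / L) * ‖t - x‖ := by
    field_simp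
  rw [hsq, hcancel]
  linarith [real_inner_le_norm e (t - x)]

/-- A discrete Gronwall-type bound for sequences controlled quadratically by their own past. -/
lemma le_add_two_mul_sum_add_sqrt {u c b : ℕ → ℝ} {u₀ : ℝ} (hu₀ : 0 ≤ u₀) (hu : ∀ i, 0 ≤ u i)
    (hc : ∀ i, 0 ≤ c i) (hb : ∀ i, 0 ≤ b i)
    (hrec : ∀ k, 1 ≤ k → u k ^ 2 ≤ u₀ ^ 2 + 2 * ∑ i ∈ Icc 1 k, b i + 2 * ∑ i ∈ Icc 1 k, c i * u i)
    {k i : ℕ} (hi : 1 ≤ i) (hik : i ≤ k) :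
    u i ≤ u₀ + 2 * ∑ i ∈ Icc 1 k, c i + √(2 * ∑ i ∈ Icc 1 k, b i) := by
  obtain ⟨m, hm, hmax⟩ := (Icc 1 k).exists_max_image u ⟨i, mem_Icc.2 ⟨hi, hik⟩⟩
  refine (hmax i (mem_Icc.2 ⟨hi, hik⟩)).trans ?_
  rw [mem_Icc] at hm
  have hsub : Icc 1 m ⊆ Icc 1 k := Icc_subset_Icc_right hm.2
  have hbm : ∑ i ∈ Icc 1 m, b i ≤ ∑ i ∈ Icc 1 k, b i :=
    sum_le_sum_of_subset_of_nonneg hsub fun i _ _ => hb i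
  have hcm : ∑ i ∈ Icc 1 m, c i * u i ≤ (∑ i ∈ Icc 1 k, c i) * u m := by
    rw [sum_mul]
    exact (sum_le_sum_of_subset_of_nonneg hsub fun i _ _ => mul_nonneg (hc i) (hu i)).trans
      (sum_le_sum fun i hi => mul_le_mul_of_nonneg_left (hmax i hi) (hc i))
  have hrecm := hrec m hm.1
  set A := ∑ i ∈ Icc 1 k, c i
  set B := ∑ i ∈ Icc 1 k, b i
  have hA : 0 ≤ A := sum_nonneg fun i _ => hc i
  have hB : 0 ≤ B := sum_nonneg fun i _ => hb i
  have hs : √(2 * B) ^ 2 = 2 * B := Real.sq_sqrt (by positivity)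
  have hs0 := Real.sqrt_nonneg (2 * B)
  by_contra! hlt
  have h1 : u₀ + √(2 * B) < u m - 2 * A := by linarith
  have h2 : u₀ + √(2 * B) ≤ u m := by linarith
  have h3 : 0 < u m := by linarith
  nlinarith [mul_lt_mul_of_pos_left h1 h3,
    mul_le_mul_of_nonneg_right h2 (add_nonneg hu₀ hs0), mul_nonneg hu₀ hs0]

theorem stmt_9
    (L : ℝ) (hL : 0 < L)
    (g : E → ℝ) (g' : E → E)
    (hgconv : ConvexOn ℝ Set.univ g)
    (hgrad : ∀ w, HasGradientAt g (g' w) w)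
    (hlip : ∀ w w', ‖g' w - g' w'‖ ≤ L * ‖w - w'‖)
    (h : E → EReal)
    (hhconv : ERealConvexOn h)
    (hhlsc : LowerSemicontinuous h)
    (hhproper : ∃ w, h w ≠ ⊤) (hhnbot : ∀ w, h w ≠ ⊥)
    (f : E → EReal) (hf : ∀ w, f w = ((g w : ℝ) : EReal) + h w)
    (xstar : E) (hmin : ∀ w, f xstar ≤ f w)
    (x y e : ℕ → E) (ε : ℕ → ℝ) (hεnn : ∀ k, 0 ≤ ε k)
    (hy0 : y 0 = x 0)
    (hy : ∀ k, 1 ≤ k → y k = x k + (((k : ℝ) - 1) / ((k : ℝ) + 2)) • (x k - x (k - 1)))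
    (hstep : ∀ k, 1 ≤ k →
      IsEpsOptimal L h (ε k) (y (k - 1) - (1 / L) • (g' (y (k - 1)) + e k)) (x k))
    (θ : ℕ → ℝ) (hθ : ∀ k, θ k = 2 / ((k : ℝ) + 1))
    (v : ℕ → E) (hv : ∀ k, v k = x (k - 1) + (1 / θ k) • (x k - x (k - 1)))
    (At Bt : ℕ → ℝ)
    (hAt : ∀ k, At k = ∑ i ∈ Icc 1 k, (i : ℝ) * (‖e i‖ / L + Real.sqrt (2 * ε i / L)))
    (hBt : ∀ k, Bt k = ∑ i ∈ Icc 1 k, (i : ℝ) ^ 2 * ε i / L)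
    :
    ∀ k, 1 ≤ k → ∀ i, 1 ≤ i → i ≤ k →
      ‖v i - xstar‖ ≤ ‖x 0 - xstar‖ + 2 * At k + Real.sqrt (2 * Bt k) := by
  obtain ⟨w₀, hw₀⟩ := hhproper
  have hstar : h xstar ≠ ⊤ := by
    intro htop
    have := hmin w₀
    rw [hf, hf, htop, EReal.coe_add_top, top_le_iff, ← EReal.coe_toReal hw₀ (hhnbot w₀)] at this
    exact absurd this (by norm_cast; exact EReal.coe_ne_top _)
  have hx (k : ℕ) (hk : 1 ≤ k) : h (x k) ≠ ⊤ := ((hstep k hk).toReal_le hhnbot hstar).1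
  have hgap (w : E) (hw : h w ≠ ⊤) :
      g xstar + (h xstar).toReal ≤ g w + (h w).toReal := by
    have := hmin w
    rw [hf, hf, ← EReal.coe_toReal hw (hhnbot w), ← EReal.coe_toReal hstar (hhnbot xstar)] at this
    exact_mod_cast this
  set c : ℕ → ℝ := fun i => i * (‖e i‖ / L + √(2 * ε i / L)) with hc
  set b : ℕ → ℝ := fun i => (i : ℝ) ^ 2 * ε i / L with hb
  have hv' (k : ℕ) : v k = x (k - 1) + (((k : ℝ) + 1) / 2) • (x k - x (k - 1)) := by
    rw [hv, hθ, one_div_div]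
  have hc0 (i : ℕ) : 0 ≤ c i := by positivity
  have hb0 (i : ℕ) : 0 ≤ b i := by
    have := hεnn i
    positivity
  have hpot (k : ℕ) (hk : 1 ≤ k) :
      ((k : ℝ) + 1) ^ 2 / (2 * L) * (g (x k) + (h (x k)).toReal - (g xstar + (h xstar).toReal)) +
        ‖v k - xstar‖ ^ 2 ≤ ‖x 0 - xstar‖ ^ 2 + 2 * ∑ i ∈ Icc 1 k, b i +
          2 * ∑ i ∈ Icc 1 k, c i * ‖v i - xstar‖ := by
    induction k, hk using Nat.le_induction with
    | base =>
      have hle := proximalGradient_step hL (hεnn 1) hgconv hgrad hlip hhconv hhnbot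
        (hstep 1 le_rfl) hstar
      have hv1 : v 1 = x 1 := by rw [hv']; norm_num
      simp only [tsub_self, hy0] at hle
      simp only [Icc_self, sum_singleton, hb, hc, hv1]
      rw [norm_sub_rev xstar, norm_sub_rev xstar] at hle
      have hmul := mul_le_mul_of_nonneg_left hle (by positivity : 0 ≤ 2 / L)
      have e1 : 2 / L * (g xstar + (h xstar).toReal +
          L / 2 * (‖x 0 - xstar‖ ^ 2 - ‖x 1 - xstar‖ ^ 2) +
          L * (‖e 1‖ / L + √(2 * ε 1 / L)) * ‖x 1 - xstar‖ + ε 1) =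
          2 / L * (g xstar + (h xstar).toReal) + (‖x 0 - xstar‖ ^ 2 - ‖x 1 - xstar‖ ^ 2) +
          2 * ((‖e 1‖ / L + √(2 * ε 1 / L)) * ‖x 1 - xstar‖) + 2 * (ε 1 / L) := by
        field_simp
      rw [e1] at hmul
      push_cast
      have e2 : ((1 : ℝ) + 1) ^ 2 / (2 * L) = 2 / L := by field_simp; norm_num
      rw [e2, one_pow, one_mul, one_mul]
      linarith
    | succ k hk ih =>
      have hk1 : (1 : ℝ) ≤ k := by exact_mod_cast hk
      obtain ⟨q, hq⟩ : ∃ q : ℝ, q = (k : ℝ) + 2 := ⟨_, rfl⟩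
      have hq0 : 0 < q := by linarith
      have h1q : 0 ≤ 1 - 2 / q := sub_nonneg.2 ((div_le_one hq0).2 (by linarith))
      obtain ⟨ht, htle⟩ := hhconv.toReal_le hhnbot (x := xstar) (y := x k) hstar (hx k hk)
        (a := 2 / q) (b := 1 - 2 / q) (by positivity) h1q (by ring)
      have hgt := hgconv.2 (Set.mem_univ xstar) (Set.mem_univ (x k))
        (by positivity : 0 ≤ 2 / q) h1q (by ring)
      simp only [smul_eq_mul] at hgt
      have hle := proximalGradient_step hL (hεnn (k + 1)) hgconv hgrad hlip hhconv hhnbot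
        (hstep (k + 1) (by omega)) ht
      simp only [Nat.add_sub_cancel] at hle
      have hty : (2 / q) • xstar + (1 - 2 / q) • x k - y k = (2 / q) • (xstar - v k) := by
        rw [hy k hk, hv' k, ← hq]
        have : (k : ℝ) = q - 2 := by linarith
        rw [this]
        match_scalars <;> field_simp <;> ring
      have htx : (2 / q) • xstar + (1 - 2 / q) • x k - x (k + 1) =
          (2 / q) • (xstar - v (k + 1)) := by
        rw [hv' (k + 1), Nat.add_sub_cancel]
        have : ((k + 1 : ℕ) : ℝ) = q - 1 := by push_cast; linarith
        rw [this]
        match_scalars <;> field_simp <;> ring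
      rw [hty, htx, norm_smul, norm_smul, Real.norm_of_nonneg (by positivity : 0 ≤ 2 / q),
        norm_sub_rev xstar, norm_sub_rev xstar] at hle
      rw [sum_Icc_succ_top (by omega), sum_Icc_succ_top (by omega)]
      have hgapk := hgap (x k) (hx k hk)
      have hbk : q ^ 2 / (2 * L) * ε (k + 1) ≤ 2 * b (k + 1) := by
        have hq2 : q ^ 2 ≤ 4 * ((k : ℝ) + 1) ^ 2 := by rw [hq]; nlinarith
        have := mul_le_mul_of_nonneg_right hq2
          (div_nonneg (hεnn (k + 1)) (by positivity : 0 ≤ 2 * L))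
        simp only [hb]
        push_cast
        calc _ = q ^ 2 * (ε (k + 1) / (2 * L)) := by ring
          _ ≤ _ := this
          _ = _ := by field_simp; ring
      have hck : q * (‖e (k + 1)‖ / L + √(2 * ε (k + 1) / L)) * ‖v (k + 1) - xstar‖ ≤
          2 * (c (k + 1) * ‖v (k + 1) - xstar‖) := by
        simp only [hc]
        push_cast
        rw [← mul_assoc, ← mul_assoc]
        gcongr
        linarith
      set V := ‖v (k + 1) - xstar‖
      set U := ‖v k - xstar‖
      set F := g xstar + (h xstar).toReal with hF
      set C := ‖e (k + 1)‖ / L + √(2 * ε (k + 1) / L)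
      have hrec : g (x (k + 1)) + (h (x (k + 1))).toReal - F ≤
          (1 - 2 / q) * (g (x k) + (h (x k)).toReal - F) +
          L / 2 * ((2 / q * U) ^ 2 - (2 / q * V) ^ 2) + L * C * (2 / q * V) + ε (k + 1) := by
        linarith
      have hmul := mul_le_mul_of_nonneg_left hrec (by positivity : 0 ≤ q ^ 2 / (2 * L))
      have e1 (d : ℝ) : q ^ 2 / (2 * L) * ((1 - 2 / q) * d +
          L / 2 * ((2 / q * U) ^ 2 - (2 / q * V) ^ 2) + L * C * (2 / q * V) + ε (k + 1)) =
          q * (q - 2) / (2 * L) * d + (U ^ 2 - V ^ 2) + q * C * V +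
            q ^ 2 / (2 * L) * ε (k + 1) := by
        field_simp
      rw [e1] at hmul
      have hcoef : q * (q - 2) / (2 * L) * (g (x k) + (h (x k)).toReal - F) ≤
          ((k : ℝ) + 1) ^ 2 / (2 * L) * (g (x k) + (h (x k)).toReal - F) := by
        refine mul_le_mul_of_nonneg_right ?_ (sub_nonneg.2 hgapk)
        refine div_le_div_of_nonneg_right ?_ (by positivity)
        rw [hq]
        nlinarith
      have hcast : ((k + 1 : ℕ) : ℝ) + 1 = q := by push_cast; linarith
      rw [hcast]
      linarith
  intro k _ i hi hik
  rw [hAt, hBt]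
  refine le_add_two_mul_sum_add_sqrt (u := fun i => ‖v i - xstar‖) (norm_nonneg _)
    (fun _ => norm_nonneg _) hc0 hb0 (fun k hk => ?_) hi hik
  have hnn : 0 ≤ ((k : ℝ) + 1) ^ 2 / (2 * L) *
      (g (x k) + (h (x k)).toReal - (g xstar + (h xstar).toReal)) :=
    mul_nonneg (by positivity) (sub_nonneg.2 (hgap (x k) (hx k hk)))
  linarith [hpot k hk]
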